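/- Let (v; w₀, …, w_{n−1}) be an embedded, immersed simplicial vertex star in ℝ³ with carrier Star = ⋃ᵢ Tᵢ. Then there exists a transverse plane through v — i.e., a unit vector u such that the orthogonal projection x ↦ x − ⟨x − v, u⟩ u is injective on Star — if and only if the Gauss image is contained in an open hemisphere, i.e., there exists a unit vector ν with ⟨mᵢ, ν⟩ > 0 for all i. (Proposition 2.13, simplicial case.) -/

import Mathlib

open RealInnerProductSpace

noncomputable section

/-- Euclidean 3-space. -/
abbrev E3 : Type := EuclideanSpace ℝ (Fin 3)

/-- The cross product on `E3`. -/
noncomputable def cross3 (a b : E3) : E3 :=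
  (WithLp.equiv 2 (Fin 3 → ℝ)).symm
    ![a 1 * b 2 - a 2 * b 1, a 2 * b 0 - a 0 * b 2, a 0 * b 1 - a 1 * b 0]

/-- The face `Tᵢ = conv {v, wᵢ, wᵢ₊₁}` of a simplicial vertex star `(v; w)`;
indices are taken modulo `n`. -/
def starFace {n : ℕ} (v : E3) (w : ZMod n → E3) (i : ZMod n) : Set E3 :=
  convexHull ℝ {v, w i, w (i + 1)}

/-- The unnormalized face normal `mᵢ = (wᵢ − v) × (wᵢ₊₁ − v)`. -/
noncomputable def starFN {n : ℕ} (v : E3) (w : ZMod n → E3) (i : ZMod n) : E3 :=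
  cross3 (w i - v) (w (i + 1) - v)

/-- The unit face normal `nᵢ = mᵢ / ‖mᵢ‖`. -/
noncomputable def starUN {n : ℕ} (v : E3) (w : ZMod n → E3) (i : ZMod n) : E3 :=
  ‖starFN v w i‖⁻¹ • starFN v w i

/-- `(v; w₀, …, w_{n−1})` is an embedded, immersed simplicial vertex star:
`n ≥ 3`; consecutive edge vectors are linearly independent; distinct faces meet
exactly in their common edge (adjacent case) or in `{v}` (non-adjacent case);
and consecutive unit normals satisfy `nᵢ₊₁ ≠ ±nᵢ`. -/
def IsStar {n : ℕ} (v : E3) (w : ZMod n → E3) : Prop :=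
  3 ≤ n ∧
  (∀ i : ZMod n, LinearIndependent ℝ ![w i - v, w (i + 1) - v]) ∧
  (∀ i : ZMod n, starUN v w (i + 1) ≠ starUN v w i ∧ starUN v w (i + 1) ≠ -starUN v w i) ∧
  (∀ i j : ZMod n, i ≠ j →
    (j = i + 1 → starFace v w i ∩ starFace v w j = segment ℝ v (w j)) ∧
    (i = j + 1 → starFace v w i ∩ starFace v w j = segment ℝ v (w i)) ∧
    (j ≠ i + 1 → i ≠ j + 1 → starFace v w i ∩ starFace v w j = {v}))

/-- The shorter great-circle arc `Arc(p, q)` joining two unit vectors `p ≠ ±q`. -/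
def sArc (p q : E3) : Set E3 :=
  {x | ∃ s t : ℝ, 0 ≤ s ∧ 0 ≤ t ∧ 0 < s + t ∧ x = ‖s • p + t • q‖⁻¹ • (s • p + t • q)}

/-- The Gauss image of the vertex star (the spherical polygon with vertices `nᵢ` and
edges `Arc(nᵢ, nᵢ₊₁)`) has no self-intersections. -/
def GaussEmb {n : ℕ} (v : E3) (w : ZMod n → E3) : Prop :=
  Function.Injective (starUN v w) ∧
  ∀ i j : ZMod n, i ≠ j →
    (j = i + 1 →
      sArc (starUN v w i) (starUN v w (i + 1)) ∩ sArc (starUN v w j) (starUN v w (j + 1)) =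
        {starUN v w j}) ∧
    (i = j + 1 →
      sArc (starUN v w i) (starUN v w (i + 1)) ∩ sArc (starUN v w j) (starUN v w (j + 1)) =
        {starUN v w i}) ∧
    (j ≠ i + 1 → i ≠ j + 1 →
      sArc (starUN v w i) (starUN v w (i + 1)) ∩ sArc (starUN v w j) (starUN v w (j + 1)) = ∅)

/-- The discrete Gaussian curvature (angle defect)
`K(v) = 2π − Σᵢ ∠(wᵢ − v, wᵢ₊₁ − v)`. -/
noncomputable def curv {n : ℕ} [NeZero n] (v : E3) (w : ZMod n → E3) : ℝ :=
  2 * Real.pi - ∑ i : ZMod n, InnerProductGeometry.angle (w i - v) (w (i + 1) - v)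

/-- The face `Tᵢ` is an inflection face: its two neighboring faces lie strictly on
opposite sides of its plane. -/
def IsInflectionFace {n : ℕ} (v : E3) (w : ZMod n → E3) (i : ZMod n) : Prop :=
  ⟪w (i - 1) - v, starFN v w i⟫ * ⟪w (i + 2) - v, starFN v w i⟫ < 0

/-- The carrier `Star = ⋃ᵢ Tᵢ` of the vertex star. -/
def starCarrier {n : ℕ} (v : E3) (w : ZMod n → E3) : Set E3 :=
  ⋃ i : ZMod n, starFace v w i

/-- The triple product. -/
def tri (a b c : E3) : ℝ := ⟪cross3 a b, c⟫

lemma tri_eq (a b c : E3) : tri a b c =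
    (a 1 * b 2 - a 2 * b 1) * c 0 + (a 2 * b 0 - a 0 * b 2) * c 1
      + (a 0 * b 1 - a 1 * b 0) * c 2 := by
  simp [tri, cross3, PiLp.inner_apply, Fin.sum_univ_three]
  ring

lemma tri_id (a b y u : E3) :
    tri y b u • a + tri a y u • b + tri a b y • u = tri a b u • y := by
  ext i
  fin_cases i <;> simp [tri_eq] <;> ring

lemma tri_comb_left (a b c u : E3) (s t : ℝ) :
    tri (s • a + t • b) c u = s * tri a c u + t * tri b c u := by
  simp [tri_eq]; ring

lemma tri_comb_mid (a b c u : E3) (s t : ℝ) :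
    tri c (s • a + t • b) u = s * tri c a u + t * tri c b u := by
  simp [tri_eq]; ring

lemma tri_comb_right (a b c d : E3) (s t : ℝ) :
    tri a b (s • c + t • d) = s * tri a b c + t * tri a b d := by
  simp [tri_eq]; ring

lemma tri_add_left (y b u : E3) (t : ℝ) : tri (y + t • u) b u = tri y b u := by
  simp [tri_eq]; ring

lemma tri_add_mid (y a u : E3) (t : ℝ) : tri a (y + t • u) u = tri a y u := by
  simp [tri_eq]; ring

lemma tri_add_right (a b y u : E3) (t : ℝ) : tri a b (y + t • u) = tri a b y + t * tri a b u := by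
  simp [tri_eq]; ring

lemma tri_swap (a b u : E3) : tri a b u = - tri b a u := by
  simp [tri_eq]; ring

lemma tri_self (a u : E3) : tri a a u = 0 := by
  simp [tri_eq]; ring

lemma tri_self_right (a b : E3) : tri a b b = 0 := by
  simp [tri_eq]; ring

lemma tri_self_left (a b : E3) : tri a b a = 0 := by
  simp [tri_eq]; ring

lemma tri_zero_left (b u : E3) : tri 0 b u = 0 := by
  simp [tri_eq]

lemma tri_zero_mid (b u : E3) : tri b 0 u = 0 := by
  simp [tri_eq]

lemma tri_neg (a b u : E3) : tri a b (-u) = - tri a b u := by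
  simp [tri_eq]; ring

lemma tri_cont_left (b u : E3) : Continuous fun y : E3 => tri y b u := by
  simp only [tri_eq]; fun_prop

lemma tri_cont_mid (a u : E3) : Continuous fun y : E3 => tri a y u := by
  simp only [tri_eq]; fun_prop

lemma tri_cont_right (a b : E3) : Continuous fun y : E3 => tri a b y := by
  simp only [tri_eq]; fun_prop

/-- The cone over a pair of vectors. -/
def cone2 (a b : E3) : Set E3 := {x | ∃ s t : ℝ, 0 ≤ s ∧ 0 ≤ t ∧ x = s • a + t • b}

lemma mem_cone2_iff {a b u : E3} (h : 0 < tri a b u) (x : E3) :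
    x ∈ cone2 a b ↔ 0 ≤ tri x b u ∧ 0 ≤ tri a x u ∧ tri a b x = 0 := by
  constructor
  · rintro ⟨s, t, hs, ht, rfl⟩
    rw [tri_comb_left, tri_comb_mid, tri_comb_right, tri_self, tri_self, tri_self_right,
      tri_self_left]
    refine ⟨by positivity, by positivity, by ring⟩
  · rintro ⟨h1, h2, h3⟩
    refine ⟨tri x b u / tri a b u, tri a x u / tri a b u, by positivity, by positivity, ?_⟩
    have := tri_id a b x u
    rw [h3, zero_smul, add_zero] at this
    rw [div_eq_inv_mul, div_eq_inv_mul, mul_smul, mul_smul, ← smul_add, this, smul_smul,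
      inv_mul_cancel₀ h.ne', one_smul]

section core
variable {n : ℕ} [NeZero n] (e : ZMod n → E3) (u : E3)

/-- The punctured cone over the star. -/
def xstar : Set E3 := {x | x ≠ 0 ∧ ∃ i, x ∈ cone2 (e i) (e (i + 1))}

/-- Points of the star with nothing strictly above them (tri version). -/
def topset : Set E3 := {x | ∀ j, 0 ≤ tri x (e (j + 1)) u → 0 ≤ tri (e j) x u →
  0 ≤ tri (e j) (e (j + 1)) x}

variable {e u}

lemma not_both_zero (hd : ∀ i, 0 < tri (e i) (e (i + 1)) u)
    {j : ZMod n} {x : E3} {i : ZMod n} (hx : x ≠ 0)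
    (hi : x ∈ cone2 (e i) (e (i + 1)))
    (h1 : tri x (e (j + 1)) u = 0) (h2 : tri (e j) x u = 0) : False := by
  have h := tri_id (e j) (e (j + 1)) x u
  rw [h1, h2, zero_smul, zero_smul, zero_add, zero_add] at h
  have hx' : x = (0 : E3) + (tri (e j) (e (j+1)) x / tri (e j) (e (j + 1)) u) • u := by
    rw [zero_add, div_eq_inv_mul, mul_smul, h, smul_smul, inv_mul_cancel₀ (hd j).ne', one_smul]
  have hu : tri (e i) (e (i + 1)) x = 0 := ((mem_cone2_iff (hd i) x).1 hi).2.2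
  set t := tri (e j) (e (j+1)) x / tri (e j) (e (j + 1)) u
  rw [hx', tri_add_right] at hu
  have h0 : tri (e i) (e (i+1)) 0 = 0 := by simp [tri_eq]
  rw [h0, zero_add] at hu
  have ht : t = 0 := (mul_eq_zero.1 hu).resolve_right (hd i).ne'
  apply hx
  rw [hx', ht]; simp

lemma xstar_preconn (hd : ∀ i, 0 < tri (e i) (e (i + 1)) u) : IsPreconnected (xstar e) := by
  have hne : ∀ i, e i ≠ 0 := by
    intro i h
    have := hd i
    rw [h, tri_zero_left] at this
    exact lt_irrefl _ this
  have hmem : ∀ i, e i ∈ {x | x ≠ 0 ∧ x ∈ cone2 (e i) (e (i + 1))} := fun i =>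
    ⟨hne i, 1, 0, zero_le_one, le_rfl, by simp⟩
  have hmem' : ∀ i, e (i + 1) ∈ {x | x ≠ 0 ∧ x ∈ cone2 (e i) (e (i + 1))} := fun i =>
    ⟨hne _, 0, 1, le_rfl, zero_le_one, by simp⟩
  have hpos : ∀ i, ∀ x ∈ {x | x ≠ 0 ∧ x ∈ cone2 (e i) (e (i + 1))},
      0 < tri x (e (i + 1)) u + tri (e i) x u := by
    rintro i x ⟨hx, hc⟩
    have h := (mem_cone2_iff (hd i) x).1 hc
    rcases h.1.lt_or_eq with h1 | h1
    · linarith [h.2.1]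
    · rcases h.2.1.lt_or_eq with h2 | h2
      · linarith
      · exact (not_both_zero hd hx hc h1.symm h2.symm).elim
  have hconv : ∀ i, Convex ℝ {x | x ≠ 0 ∧ x ∈ cone2 (e i) (e (i + 1))} := by
    rintro i x hx y hy a b ha hb hab
    have hx' := hpos i x hx
    have hy' := hpos i y hy
    constructor
    · intro h0
      have h1 := tri_comb_left x y (e (i + 1)) u a b
      have h2 := tri_comb_mid x y (e i) u a b
      rw [h0, tri_zero_left] at h1
      rw [h0, tri_zero_mid] at h2
      have h3 : a * (tri x (e (i + 1)) u + tri (e i) x u) +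
        b * (tri y (e (i + 1)) u + tri (e i) y u) = 0 := by linarith
      have h4 := mul_nonneg ha hx'.le
      have h5 := mul_nonneg hb hy'.le
      have h6 : a = 0 := (mul_eq_zero.1 (by linarith : a * _ = 0)).resolve_right hx'.ne'
      have h7 : b = 0 := (mul_eq_zero.1 (by linarith : b * _ = 0)).resolve_right hy'.ne'
      linarith
    · obtain ⟨-, s, t, hs, ht, rfl⟩ := hx
      obtain ⟨-, s', t', hs', ht', rfl⟩ := hy
      exact ⟨a * s + b * s', a * t + b * t', by positivity, by positivity, by module⟩
  -- every point is joined to e 0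
  have hchain : ∀ k : ℕ, ∃ s ⊆ xstar e, e 0 ∈ s ∧ e (k : ZMod n) ∈ s ∧ IsPreconnected s := by
    intro k
    induction k with
    | zero =>
      exact ⟨{e 0}, by rintro _ rfl; exact ⟨hne 0, 0, (hmem 0).2⟩, rfl, by simp,
        isPreconnected_singleton⟩
    | succ k ih =>
      obtain ⟨s, hs, h0, hk, hc⟩ := ih
      refine ⟨s ∪ {x | x ≠ 0 ∧ x ∈ cone2 (e k) (e (k + 1))}, ?_, Or.inl h0, Or.inr ?_, ?_⟩
      · apply Set.union_subset hs
        exact fun x hx => ⟨hx.1, _, hx.2⟩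
      · push_cast
        exact hmem' _
      · exact hc.union _ hk (hmem _) (hconv _).isPreconnected
  apply isPreconnected_of_forall (e 0)
  rintro y ⟨hy, i, hi⟩
  obtain ⟨s, hs, h0, hk, hc⟩ := hchain i.val
  rw [ZMod.natCast_zmod_val] at hk
  refine ⟨s ∪ {x | x ≠ 0 ∧ x ∈ cone2 (e i) (e (i + 1))}, ?_, Or.inl h0, Or.inr ⟨hy, hi⟩, ?_⟩
  · apply Set.union_subset hs
    exact fun x hx => ⟨hx.1, _, hx.2⟩
  · exact hc.union _ hk (hmem _) (hconv _).isPreconnected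

open Filter Topology in
/-- The complement of the top set is open. -/
lemma top_compl_nhds (hd : ∀ i, 0 < tri (e i) (e (i + 1)) u) {x : E3} (hx : x ∈ xstar e)
    (hT : x ∉ topset e u) : ∀ᶠ y in 𝓝 x, y ∉ topset e u := by
  obtain ⟨hx0, i0, hi0⟩ := hx
  have key : ∃ j, 0 < tri x (e (j + 1)) u ∧ 0 ≤ tri (e j) x u ∧
      tri (e j) (e (j + 1)) x < 0 := by
    simp only [topset, Set.mem_ofPred_eq, not_forall, not_le] at hT
    obtain ⟨j, h1, h2, h3⟩ := hT
    rcases h1.lt_or_eq with h1' | h1'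
    · exact ⟨j, h1', h2, h3⟩
    · have h2' : 0 < tri (e j) x u := lt_of_le_of_ne h2 fun h =>
        not_both_zero hd hx0 hi0 h1'.symm h.symm
      have hid := tri_id (e j) (e (j + 1)) x u
      have hdj := hd j
      have hdj1 := hd (j + 1)
      rw [← h1', zero_smul, zero_add] at hid
      refine ⟨j + 1, ?_, ?_, ?_⟩
      · have := congrArg (fun z => tri z (e (j + 1 + 1)) u) hid
        simp only [tri_add_left] at this
        have e1 := tri_comb_left (e (j+1)) 0 (e (j + 1 + 1)) u (tri (e j) x u) 0
        have e2 := tri_comb_left x 0 (e (j + 1 + 1)) u (tri (e j) (e (j+1)) u) 0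
        simp only [smul_zero, add_zero, zero_mul] at e1 e2
        rw [e1, e2] at this
        have hp : 0 < tri (e j) (e (j+1)) u * tri x (e (j + 1 + 1)) u := by
          rw [← this]; positivity
        exact pos_of_mul_pos_right hp hdj.le
      · rw [tri_swap, ← h1', neg_zero]
      · have := congrArg (fun z => tri (e (j+1)) (e (j + 1 + 1)) z) hid
        simp only [tri_comb_right, tri_self_left] at this
        have e2 := tri_comb_right (e (j+1)) (e (j + 1 + 1)) x 0 (tri (e j) (e (j+1)) u) 0
        simp only [smul_zero, add_zero, zero_mul] at e2
        rw [e2] at this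
        by_contra hcon
        push Not at hcon
        have := mul_nonneg hdj.le hcon
        have := mul_neg_of_neg_of_pos h3 hdj1
        linarith
  obtain ⟨j, h1, h2, h3⟩ := key
  have ev1 := (tri_cont_left (e (j + 1)) u).continuousAt.eventually (lt_mem_nhds h1)
  have ev3 := (tri_cont_right (e j) (e (j + 1))).continuousAt.eventually (gt_mem_nhds h3)
  rcases h2.lt_or_eq with h2' | h2'
  · have ev2 := (tri_cont_mid (e j) u).continuousAt.eventually (lt_mem_nhds h2')
    filter_upwards [ev1, ev2, ev3] with y g1 g2 g3 hy
    exact absurd (hy j g1.le g2.le) (not_le.2 g3)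
  · obtain ⟨k, rfl⟩ : ∃ k, j = k + 1 := ⟨j - 1, by ring⟩
    have hid := tri_id (e (k + 1)) (e (k + 1 + 1)) x u
    have hdk := hd k
    have hdj := hd (k + 1)
    rw [← h2', zero_smul, add_zero] at hid
    have p1 : 0 < tri (e k) x u := by
      have := congrArg (fun z => tri (e k) z u) hid
      simp only [tri_add_mid] at this
      have e1 := tri_comb_mid (e (k+1)) 0 (e k) u (tri x (e (k + 1 + 1)) u) 0
      have e2 := tri_comb_mid x 0 (e k) u (tri (e (k + 1)) (e (k + 1 + 1)) u) 0
      simp only [smul_zero, add_zero, zero_mul] at e1 e2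
      rw [e1, e2] at this
      have hp : 0 < tri (e (k + 1)) (e (k + 1 + 1)) u * tri (e k) x u := by
        rw [← this]; positivity
      exact pos_of_mul_pos_right hp hdj.le
    have p2 : tri (e k) (e (k + 1)) x < 0 := by
      have := congrArg (fun z => tri (e k) (e (k + 1)) z) hid
      simp only [tri_comb_right, tri_self_right] at this
      have e2 := tri_comb_right (e k) (e (k + 1)) x 0 (tri (e (k + 1)) (e (k + 1 + 1)) u) 0
      simp only [smul_zero, add_zero, zero_mul] at e2
      rw [e2] at this
      by_contra hcon
      push Not at hcon
      have := mul_nonneg hdj.le hcon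
      have := mul_neg_of_neg_of_pos h3 hdk
      linarith
    have ev4 := (tri_cont_mid (e k) u).continuousAt.eventually (lt_mem_nhds p1)
    have ev5 := (tri_cont_right (e k) (e (k + 1))).continuousAt.eventually (gt_mem_nhds p2)
    filter_upwards [ev1, ev3, ev4, ev5] with y g1 g3 g4 g5 hy
    rcases le_total 0 (tri (e (k + 1)) y u) with h | h
    · exact absurd (hy (k + 1) g1.le h) (not_le.2 g3)
    · refine absurd (hy k ?_ g4.le) (not_le.2 g5)
      rw [tri_swap]; linarith

open Filter Topology in
/-- The top set is open in the punctured cone. -/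
lemma top_nhds (hd : ∀ i, 0 < tri (e i) (e (i + 1)) u)
    (hna : ∀ i j, i ≠ j → j ≠ i + 1 → i ≠ j + 1 →
      ∀ x, x ∈ cone2 (e i) (e (i + 1)) → x ∈ cone2 (e j) (e (j + 1)) → x = 0)
    {x : E3} (hx : x ∈ xstar e)
    (hT : x ∈ topset e u) : ∀ᶠ y in 𝓝[xstar e] x, y ∈ topset e u := by
  have main : ∀ j k, ∀ᶠ y in 𝓝 x, y ∈ cone2 (e k) (e (k + 1)) →
      0 ≤ tri y (e (j + 1)) u → 0 ≤ tri (e j) y u → 0 ≤ tri (e j) (e (j + 1)) y := by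
    intro j k
    by_cases hk : x ∈ cone2 (e k) (e (k + 1))
    swap
    · have : IsClosed (cone2 (e k) (e (k + 1))) := by
        have : cone2 (e k) (e (k + 1)) = {x | 0 ≤ tri x (e (k + 1)) u} ∩
            ({x | 0 ≤ tri (e k) x u} ∩ {x | tri (e k) (e (k + 1)) x = 0}) := by
          ext x
          exact mem_cone2_iff (hd k) x
        rw [this]
        exact (isClosed_le continuous_const (tri_cont_left _ _)).inter
          ((isClosed_le continuous_const (tri_cont_mid _ _)).inter
            (isClosed_eq (tri_cont_right _ _) continuous_const))
      filter_upwards [this.isOpen_compl.mem_nhds hk] with y hy h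
      exact absurd h hy
    rcases lt_or_ge (tri x (e (j + 1)) u) 0 with h1 | h1
    · filter_upwards [(tri_cont_left (e (j + 1)) u).continuousAt.eventually (gt_mem_nhds h1)]
        with y hy _ h
      exact absurd h (not_le.2 hy)
    rcases lt_or_ge (tri (e j) x u) 0 with h2 | h2
    · filter_upwards [(tri_cont_mid (e j) u).continuousAt.eventually (gt_mem_nhds h2)]
        with y hy _ _ h
      exact absurd h (not_le.2 hy)
    have h3 := hT j h1 h2
    rcases h3.lt_or_eq with h3 | h3
    · filter_upwards [(tri_cont_right (e j) (e (j + 1))).continuousAt.eventually (lt_mem_nhds h3)]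
        with y hy _ _ _
      exact hy.le
    have hj : x ∈ cone2 (e j) (e (j + 1)) := (mem_cone2_iff (hd j) x).2 ⟨h1, h2, h3.symm⟩
    refine Eventually.of_forall fun y hy g1 g2 => ?_
    by_cases hjk : j = k
    · subst hjk
      exact ((mem_cone2_iff (hd j) y).1 hy).2.2.ge
    by_cases hkj : k = j + 1
    · subst hkj
      obtain ⟨s, t, hs, ht, rfl⟩ := hy
      rw [tri_comb_left, tri_self, tri_swap] at g1
      have ht0 : t = 0 := by
        by_contra h
        have := mul_pos (lt_of_le_of_ne ht (Ne.symm h)) (hd (j + 1))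
        linarith
      rw [tri_comb_right, tri_self_right, ht0]
      simp
    by_cases hjk' : j = k + 1
    · subst hjk'
      obtain ⟨s, t, hs, ht, rfl⟩ := hy
      rw [tri_comb_mid, tri_self, tri_swap] at g2
      have ht0 : s = 0 := by
        by_contra h
        have := mul_pos (lt_of_le_of_ne hs (Ne.symm h)) (hd k)
        linarith
      rw [tri_comb_right, tri_self_left, ht0]
      simp
    exact absurd (hna j k hjk hkj hjk' x hj hk) hx.1
  have main' := eventually_all.2 fun j => eventually_all.2 (main j)
  filter_upwards [mem_nhdsWithin_of_mem_nhds main', self_mem_nhdsWithin] with y hy hyX j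
  obtain ⟨-, k, hk⟩ := hyX
  exact hy j k hk

lemma topset_nonempty (hd : ∀ i, 0 < tri (e i) (e (i + 1)) u) :
    ∃ x ∈ xstar e, x ∈ topset e u := by
  classical
  let F : Finset (ZMod n) := Finset.univ.filter fun j =>
    0 ≤ tri (e 0) (e (j + 1)) u ∧ 0 ≤ tri (e j) (e 0) u
  have hF : F.Nonempty := ⟨0, by
    simp only [F, Finset.mem_filter, Finset.mem_univ, true_and]
    exact ⟨(hd 0).le, (tri_self _ _).ge⟩⟩
  obtain ⟨j, hj, hmax⟩ := F.exists_max_image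
    (fun j => - tri (e j) (e (j + 1)) (e 0) / tri (e j) (e (j + 1)) u) hF
  simp only [F, Finset.mem_filter, Finset.mem_univ, true_and] at hj hmax
  set t := - tri (e j) (e (j + 1)) (e 0) / tri (e j) (e (j + 1)) u with ht
  refine ⟨e 0 + t • u, ⟨?_, j, ?_⟩, ?_⟩
  · intro h
    have := tri_add_left (e 0) (e (0 + 1)) u t
    rw [h, tri_zero_left] at this
    exact (hd 0).ne this
  · rw [mem_cone2_iff (hd j), tri_add_left, tri_add_mid, tri_add_right]
    refine ⟨hj.1, hj.2, ?_⟩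
    rw [ht, div_mul_cancel₀ _ (hd j).ne']; ring
  · intro k h1 h2
    rw [tri_add_left] at h1
    rw [tri_add_mid] at h2
    have := hmax k ⟨h1, h2⟩
    rw [div_le_iff₀ (hd k)] at this
    rw [tri_add_right]
    linarith

lemma core_top (hd : ∀ i, 0 < tri (e i) (e (i + 1)) u)
    (hna : ∀ i j, i ≠ j → j ≠ i + 1 → i ≠ j + 1 →
      ∀ x, x ∈ cone2 (e i) (e (i + 1)) → x ∈ cone2 (e j) (e (j + 1)) → x = 0)
    {x : E3} (hx : x ∈ xstar e) : x ∈ topset e u := by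
  obtain ⟨y, hy, hyT⟩ := topset_nonempty hd
  have := (xstar_preconn hd).induction₂ (fun a b => (a ∈ topset e u ↔ b ∈ topset e u))
    (fun a ha => by
      by_cases h : a ∈ topset e u
      · filter_upwards [top_nhds hd hna ha h] with b hb
        simp [h, hb]
      · filter_upwards [mem_nhdsWithin_of_mem_nhds (top_compl_nhds hd ha h)] with b hb
        have hb' : b ∉ topset e u := hb
        simp [h, hb'])
    (fun _ _ _ _ _ _ h1 h2 => h1.trans h2) (fun _ _ _ _ h => h.symm) hy hx
  exact this.1 hyT

lemma core_le (hd : ∀ i, 0 < tri (e i) (e (i + 1)) u)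
    (hna : ∀ i j, i ≠ j → j ≠ i + 1 → i ≠ j + 1 →
      ∀ x, x ∈ cone2 (e i) (e (i + 1)) → x ∈ cone2 (e j) (e (j + 1)) → x = 0)
    {i j : ZMod n} {x : E3} {t : ℝ} (hx : x ∈ cone2 (e i) (e (i + 1)))
    (hy : x + t • u ∈ cone2 (e j) (e (j + 1))) : t ≤ 0 := by
  obtain ⟨h1, h2, h3⟩ := (mem_cone2_iff (hd j) _).1 hy
  rw [tri_add_left] at h1
  rw [tri_add_mid] at h2
  rw [tri_add_right] at h3
  have h4 : 0 ≤ tri (e j) (e (j + 1)) x := by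
    by_cases hx0 : x = 0
    · subst hx0; simp [tri_eq]
    · exact core_top hd hna ⟨hx0, i, hx⟩ j h1 h2
  by_contra! h
  have := mul_pos h (hd j)
  linarith

end core

section faces
variable {n : ℕ} {v : E3} {w : ZMod n → E3}

lemma face_sub_cone {i : ZMod n} {p : E3} (hp : p ∈ starFace v w i) :
    p - v ∈ cone2 (w i - v) (w (i + 1) - v) := by
  have hc : Convex ℝ {p : E3 | p - v ∈ cone2 (w i - v) (w (i + 1) - v)} := by
    rintro x ⟨s, t, hs, ht, hx⟩ y ⟨s', t', hs', ht', hy⟩ a b ha hb hab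
    refine ⟨a * s + b * s', a * t + b * t', by positivity, by positivity, ?_⟩
    have : a • x + b • y - v = a • (x - v) + b • (y - v) := by
      have hv : v = (a + b) • v := by rw [hab, one_smul]
      nth_rewrite 1 [hv]
      module
    rw [this, hx, hy]
    module
  refine convexHull_min ?_ hc hp
  rintro x (rfl | rfl | rfl)
  · exact ⟨0, 0, le_rfl, le_rfl, by simp⟩
  · exact ⟨1, 0, zero_le_one, le_rfl, by simp⟩
  · exact ⟨0, 1, le_rfl, zero_le_one, by simp⟩

lemma cone_scale {i : ZMod n} {x : E3} (hx : x ∈ cone2 (w i - v) (w (i + 1) - v)) :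
    ∃ c₀ : ℝ, 0 < c₀ ∧ ∀ c, 0 ≤ c → c ≤ c₀ → v + c • x ∈ starFace v w i := by
  obtain ⟨s, t, hs, ht, rfl⟩ := hx
  refine ⟨1 / (1 + s + t), by positivity, fun c hc hc' => ?_⟩
  rw [le_div_iff₀ (by positivity)] at hc'
  have hconv := convex_convexHull ℝ ({v, w i, w (i + 1)} : Set E3)
  have h1 : v ∈ starFace v w i := subset_convexHull ℝ _ (by simp)
  have h2 : w i ∈ starFace v w i := subset_convexHull ℝ _ (by simp)
  have h3 : w (i + 1) ∈ starFace v w i := subset_convexHull ℝ _ (by simp)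
  have := hconv.sum_mem (t := Finset.univ) (w := ![1 - c * s - c * t, c * s, c * t])
    (z := ![v, w i, w (i + 1)])
    (by
      intro k _
      have := mul_nonneg hc hs
      have := mul_nonneg hc ht
      fin_cases k
      · simp; nlinarith
      · simpa
      · simpa)
    (by simp [Fin.sum_univ_three]; ring)
    (by
      intro k _
      fin_cases k
      · exact h1
      · exact h2
      · exact h3)
  simp only [Fin.sum_univ_three] at this
  have e : v + c • (s • (w i - v) + t • (w (i + 1) - v)) =
    (1 - c * s - c * t) • v + (c * s) • w i + (c * t) • w (i + 1) := by module
  rw [e]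
  exact this

lemma cone_scale₂ {i j : ZMod n} {x y : E3} (hx : x ∈ cone2 (w i - v) (w (i + 1) - v))
    (hy : y ∈ cone2 (w j - v) (w (j + 1) - v)) :
    ∃ c : ℝ, 0 < c ∧ v + c • x ∈ starFace v w i ∧ v + c • y ∈ starFace v w j := by
  obtain ⟨c, hc, h⟩ := cone_scale hx
  obtain ⟨c', hc', h'⟩ := cone_scale hy
  exact ⟨min c c', lt_min hc hc', h _ (lt_min hc hc').le (min_le_left _ _),
    h' _ (lt_min hc hc').le (min_le_right _ _)⟩

lemma star_nonadj (hstar : IsStar v w) (i j : ZMod n) (hij : i ≠ j) (h1 : j ≠ i + 1)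
    (h2 : i ≠ j + 1) (x : E3) (hi : x ∈ cone2 (w i - v) (w (i + 1) - v))
    (hj : x ∈ cone2 (w j - v) (w (j + 1) - v)) : x = 0 := by
  obtain ⟨c, hc, g1, g2⟩ := cone_scale₂ hi hj
  have := (hstar.2.2.2 i j hij).2.2 h1 h2
  have hm : v + c • x ∈ ({v} : Set E3) := this ▸ ⟨g1, g2⟩
  have hm' : v + c • x = v := hm
  rw [add_eq_left, smul_eq_zero] at hm'
  exact hm'.resolve_left hc.ne'

lemma star_adj (hstar : IsStar v w) (i : ZMod n)
    (x : E3) (hi : x ∈ cone2 (w i - v) (w (i + 1) - v))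
    (hj : x ∈ cone2 (w (i + 1) - v) (w (i + 1 + 1) - v)) : ∃ r : ℝ, x = r • (w (i + 1) - v) := by
  obtain ⟨c, hc, g1, g2⟩ := cone_scale₂ hi hj
  have hne : i ≠ i + 1 := by
    intro h
    have h1 : (1 : ZMod n) = 0 := by
      rw [left_eq_add] at h; exact h
    have : Fact (1 < n) := ⟨by have := hstar.1; omega⟩
    exact one_ne_zero h1
  have := (hstar.2.2.2 i (i + 1) hne).1 rfl
  have hm : v + c • x ∈ segment ℝ v (w (i + 1)) := this ▸ ⟨g1, g2⟩
  rw [segment_eq_image'] at hm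
  obtain ⟨θ, -, hθ⟩ := hm
  have hθ' : θ • (w (i + 1) - v) = c • x := add_left_cancel hθ
  refine ⟨c⁻¹ * θ, ?_⟩
  rw [mul_smul, hθ', smul_smul, inv_mul_cancel₀ hc.ne', one_smul]

/-- Injectivity along `u` on the cone over the star. -/
def ConeInj (v : E3) (w : ZMod n → E3) (u : E3) : Prop :=
  ∀ (i j : ZMod n) (x y : E3) (t : ℝ), x ∈ cone2 (w i - v) (w (i + 1) - v) →
    y ∈ cone2 (w j - v) (w (j + 1) - v) → x = y + t • u → x = y

lemma coneInj_neg {u : E3} (h : ConeInj v w u) : ConeInj v w (-u) := by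
  intro i j x y t hx hy e
  exact h i j x y (-t) hx hy (by rw [e]; module)

lemma coneInj_of_injOn {u : E3} (hu : ‖u‖ = 1)
    (h : Set.InjOn (fun x : E3 => x - ⟪x - v, u⟫ • u) (starCarrier v w)) : ConeInj v w u := by
  intro i j x y t hx hy e
  obtain ⟨c, hc, g1, g2⟩ := cone_scale₂ hx hy
  have := h (Set.mem_iUnion.2 ⟨i, g1⟩) (Set.mem_iUnion.2 ⟨j, g2⟩) (by
    simp only [add_sub_cancel_left]
    rw [e]
    simp only [inner_add_left, inner_smul_left, real_inner_self_eq_norm_sq, hu]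
    simp only [conj_trivial]
    module)
  have := add_left_cancel this
  exact smul_right_injective _ hc.ne' this

lemma cross_ne_zero {a b : E3} (h : LinearIndependent ℝ ![a, b]) : cross3 a b ≠ 0 := by
  intro h0
  rw [LinearIndependent.pair_iff] at h
  have h0' : ∀ i, cross3 a b i = 0 := by simp [h0]
  have m0 := h0' 0
  have m1 := h0' 1
  have m2 := h0' 2
  simp [cross3] at m0 m1 m2
  have hb : ∀ k : Fin 3, b k = 0 := by
    intro k
    refine (h (b k) (-a k) ?_).1
    ext l
    fin_cases k <;> fin_cases l <;> simp <;> linarith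
  have := (h 0 1 (by ext l; simp [hb])).2
  exact one_ne_zero this

lemma coneInj_ne (hstar : IsStar v w) {u : E3} (hu : u ≠ 0) (h : ConeInj v w u) (i : ZMod n) :
    tri (w i - v) (w (i + 1) - v) u ≠ 0 := by
  intro h0
  have hm := cross_ne_zero (hstar.2.1 i)
  set a := w i - v with ha
  set b := w (i + 1) - v with hb
  have hpos : 0 < tri a b (cross3 a b) := by
    rw [tri, real_inner_self_eq_norm_sq]
    positivity
  have hid := tri_id a b u (cross3 a b)
  rw [h0, zero_smul, add_zero] at hid
  set α := tri u b (cross3 a b)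
  set β := tri a u (cross3 a b)
  have := h i i ((|α|+ α) • a + (|β| + β) • b) (|α| • a + |β| • b) (tri a b (cross3 a b))
    ⟨_, _, by linarith [neg_abs_le α], by linarith [neg_abs_le β], rfl⟩
    ⟨_, _, abs_nonneg _, abs_nonneg _, rfl⟩ (by rw [← hid]; module)
  have h' : α • a + β • b = 0 := by
    have e : α • a + β • b = ((|α|+ α) • a + (|β| + β) • b) - (|α| • a + |β| • b) := by module
    rw [e, this, sub_self]
  rw [h'] at hid
  rcases smul_eq_zero.1 hid.symm with h1 | h1
  · exact hpos.ne' h1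
  · exact hu h1

lemma coneInj_step (hstar : IsStar v w) {u : E3} (hu : u ≠ 0) (h : ConeInj v w u) (i : ZMod n)
    (hi : 0 < tri (w i - v) (w (i + 1) - v) u) :
    0 < tri (w (i + 1) - v) (w (i + 1 + 1) - v) u := by
  by_contra hcon
  have hc : tri (w (i + 1) - v) (w (i + 1 + 1) - v) u < 0 :=
    lt_of_le_of_ne (not_lt.1 hcon) (coneInj_ne hstar hu h (i + 1))
  have hid := tri_id (w i - v) (w (i + 1) - v) (w (i + 1 + 1) - v) u
  rw [tri_swap (w (i + 1 + 1) - v)] at hid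
  have hli := LinearIndependent.pair_iff.1 (hstar.2.1 (i + 1))
  have hadj := star_adj hstar i
  have hh := h (i + 1) i
  set a := w i - v
  set b := w (i + 1) - v
  set c := w (i + 1 + 1) - v
  set α := tri a b u
  set γ := tri b c u
  set δ := tri a c u
  have key := hh (|δ| • b + α • c) ((-γ) • a + (|δ| + δ) • b) (tri a b c)
    ⟨_, _, abs_nonneg _, hi.le, rfl⟩
    ⟨_, _, by linarith, by linarith [neg_abs_le δ], rfl⟩ (by rw [← hid]; module)
  obtain ⟨r, hr⟩ := hadj (|δ| • b + α • c)
    (by rw [key]; exact ⟨_, _, by linarith, by linarith [neg_abs_le δ], rfl⟩)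
    ⟨_, _, abs_nonneg _, hi.le, rfl⟩
  have := (hli (|δ| - r) α (by
    have e : (|δ| - r) • b + α • c = (|δ| • b + α • c) - r • b := by module
    rw [e, hr, sub_self])).2
  exact hi.ne' this

lemma coneInj_all [NeZero n] (hstar : IsStar v w) {u : E3} (hu : u ≠ 0) (h : ConeInj v w u)
    (h0 : 0 < tri (w 0 - v) (w (0 + 1) - v) u) (i : ZMod n) :
    0 < tri (w i - v) (w (i + 1) - v) u := by
  have : ∀ k : ℕ, 0 < tri (w (k : ZMod n) - v) (w ((k : ZMod n) + 1) - v) u := by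
    intro k
    induction k with
    | zero => simpa using h0
    | succ k ih =>
      push_cast
      exact coneInj_step hstar hu h _ ih
  have := this i.val
  rwa [ZMod.natCast_zmod_val] at this

end faces

/-- Proposition 2.13, simplicial case: there is a transverse plane through the central
vertex `v` of an embedded, immersed simplicial vertex star (a unit vector `u` such that
orthogonal projection along `u` is injective on the carrier of the star) if and only if
the Gauss image is contained in an open hemisphere (there is a unit vector `ν` with
`⟨mᵢ, ν⟩ > 0` for all `i`). -/
theorem stmt5 {n : ℕ} (v : E3) (w : ZMod n → E3) (hstar : IsStar v w) :
    (∃ u : E3, ‖u‖ = 1 ∧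
        Set.InjOn (fun x : E3 => x - ⟪x - v, u⟫ • u) (starCarrier v w)) ↔
    (∃ ν : E3, ‖ν‖ = 1 ∧ ∀ i : ZMod n, 0 < ⟪starFN v w i, ν⟫) := by
  haveI : NeZero n := ⟨by have := hstar.1; omega⟩
  constructor
  · rintro ⟨u, hu, hinj⟩
    have hu0 : u ≠ 0 := by
      rintro rfl
      simp at hu
    have hc := coneInj_of_injOn hu hinj
    rcases lt_or_gt_of_ne (coneInj_ne hstar hu0 hc 0) with h | h
    · refine ⟨-u, by rwa [norm_neg], fun i => ?_⟩
      exact coneInj_all hstar (neg_ne_zero.2 hu0) (coneInj_neg hc)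
        (by rw [tri_neg]; linarith) i
    · exact ⟨u, hu, fun i => coneInj_all hstar hu0 hc h i⟩
  · rintro ⟨u, hu, hpos⟩
    refine ⟨u, hu, ?_⟩
    intro p hp q hq hpq
    obtain ⟨i, hi⟩ := Set.mem_iUnion.1 hp
    obtain ⟨j, hj⟩ := Set.mem_iUnion.1 hq
    have hd : ∀ i, 0 < tri ((fun k => w k - v) i) ((fun k => w k - v) (i + 1)) u := hpos
    have hna := star_nonadj hstar
    have hi' := face_sub_cone hi
    have hj' := face_sub_cone hj
    simp only at hpq
    set s := ⟪p - v, u⟫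
    set t := ⟪q - v, u⟫
    have e1 : q - v = (p - v) + (t - s) • u := by
      have : q = p - s • u + t • u := by rw [hpq]; abel
      rw [this]; module
    have e2 : p - v = (q - v) + (s - t) • u := by
      rw [e1]; module
    have l1 := core_le (e := fun k => w k - v) hd hna hi' (e1 ▸ hj')
    have l2 := core_le (e := fun k => w k - v) hd hna hj' (e2 ▸ hi')
    have hst : s = t := by linarith
    rw [hst] at hpq
    exact sub_left_injective hpq
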